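/- Let K be an algebraically closed field and let X = {F = 0} ⊂ ℙ³_K be a quartic surface whose singular locus Sing(X) is a finite set. If X has a triple point, then |Sing(X)| ≤ 7. -/

import Mathlib

open MvPolynomial

noncomputable section

/-- The singular locus of the surface `{F = 0} ⊆ ℙ³_K`: the set of points of `ℙ³_K` at which
`F` and all four partial derivatives of `F` vanish (tested on every representative vector). -/
def singLocus {K : Type*} [Field K] (F : MvPolynomial (Fin 4) K) :
    Set (Projectivization K (Fin 4 → K)) :=
  {p | ∀ (v : Fin 4 → K) (hv : v ≠ 0), Projectivization.mk K v hv = p →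
      (eval v F = 0 ∧ ∀ i, eval v (pderiv i F) = 0)}


lemma order_aux {K σ : Type*} [Field K] (p q : MvPolynomial σ K) (n : ℕ)
    (h : (p * q).IsHomogeneous n) (h0 : coeff 0 p ≠ 0) :
    ∀ (m : ℕ) (d : σ →₀ ℕ), d.degree = m → m < n → coeff d q = 0 := by
  classical
  intro m
  induction m using Nat.strong_induction_on with
  | _ m ih =>
    intro d hd hm
    have h1 : coeff d (p * q) = 0 := h.coeff_eq_zero (by omega)
    rw [coeff_mul, Finset.sum_eq_single (0, d)] at h1
    · simpa [h0] using h1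
    · rintro ⟨a, b⟩ hab hne
      rw [Finset.HasAntidiagonal.mem_antidiagonal] at hab
      simp only at hab ⊢
      have hdeg : a.degree + b.degree = d.degree := by rw [← hab, map_add]
      have ha : a ≠ 0 := by
        rintro rfl
        apply hne
        simpa using hab
      have ha' : a.degree ≠ 0 := by rwa [Ne, Finsupp.degree_eq_zero_iff]
      rw [ih b.degree (by omega) b rfl (by omega), mul_zero]
    · intro hh
      exact absurd (Finset.HasAntidiagonal.mem_antidiagonal.2 (zero_add d)) hh

lemma isUnit_of_coeff_zero {K σ : Type*} [Field K] (p q : MvPolynomial σ K) (n : ℕ)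
    (h : (p * q).IsHomogeneous n) (hne : p * q ≠ 0) (h0 : coeff 0 p ≠ 0) : IsUnit p := by
  have hp := left_ne_zero_of_mul hne
  have hq := right_ne_zero_of_mul hne
  have ht := totalDegree_mul_of_isDomain hp hq
  rw [h.totalDegree hne] at ht
  obtain ⟨d, hd⟩ := ne_zero_iff.1 hq
  have h1 : n ≤ d.degree := by
    by_contra hc
    exact hd (order_aux p q n h h0 _ d rfl (by omega))
  have h2 : d.degree ≤ q.totalDegree := le_totalDegree (mem_support_iff.2 hd)
  have h3 : p.totalDegree = 0 := by omega
  rw [totalDegree_eq_zero_iff_eq_C] at h3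
  rw [h3]
  exact (isUnit_iff_ne_zero.2 h0).map C

lemma finrank_hom {K : Type*} [Field K] (n : ℕ) :
    Module.finrank K (homogeneousSubmodule (Fin 3) K n) = (n + 2).choose 2 := by
  rw [homogeneousSubmodule_eq_finsupp_supported]
  have h := Module.finrank_eq_nat_card_basis
    (basisRestrictSupport K {d : Fin 3 →₀ ℕ | d.degree = n})
  refine Eq.trans h ?_
  have hs : {d : Fin 3 →₀ ℕ | d.degree = n} =
      ↑(Finset.univ.finsuppAntidiag n : Finset (Fin 3 →₀ ℕ)) := by
    ext d
    simp [Finset.mem_finsuppAntidiag, Finsupp.degree_eq_sum]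
  rw [hs]
  simp only [Nat.card_eq_fintype_card, Finset.coe_sort_coe, Fintype.card_coe]
  rw [Finset.card_finsuppAntidiag_nat_eq_choose]
  simp only [Finset.card_univ, Fintype.card_fin]
  rw [show 3 + n - 1 = n + 2 by omega, Nat.choose_symm_add]

instance {K : Type*} [Field K] (n : ℕ) :
    Module.Finite K (homogeneousSubmodule (Fin 3) K n) :=
  Module.Finite.iff_fg.2 (homogeneousSubmodule_fg _ _ n)

lemma comp_mul {K σ : Type*} [Field K] (c B : MvPolynomial σ K) (m n : ℕ)
    (hB : B.IsHomogeneous n) (h : (c * B).IsHomogeneous (m + n)) :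
    c * B = homogeneousComponent m c * B := by
  classical
  have h1 := homogeneousComponent_of_mem (m := m+n) (n := m+n) ((mem_homogeneousSubmodule _ _).2 h)
  rw [if_pos rfl] at h1
  rw [← h1]
  conv_lhs => rw [← sum_homogeneousComponent c, Finset.sum_mul, map_sum]
  have h2 : ∀ i, homogeneousComponent (m+n) (homogeneousComponent i c * B) =
      if i = m then homogeneousComponent m c * B else 0 := by
    intro i
    rw [homogeneousComponent_of_mem ((mem_homogeneousSubmodule _ _).2
      ((homogeneousComponent_isHomogeneous i c).mul hB))]
    by_cases hi : i = m
    · subst hi; simp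
    · rw [if_neg (by omega), if_neg hi]
  simp only [h2]
  rw [Finset.sum_ite_eq']
  split_ifs with hm
  · rfl
  · rw [homogeneousComponent_eq_zero _ _ (by simpa using hm), zero_mul]

lemma eval_bind {K : Type*} [Field K] (M : Matrix (Fin 4) (Fin 4) K)
    (v : Fin 4 → K) (p : MvPolynomial (Fin 4) K) :
    eval v (bind₁ (fun i => ∑ j, C (M i j) * X j) p) = eval (M.mulVec v) p := by
  rw [← aeval_eq_eval, aeval_bind₁, ← aeval_eq_eval]
  simp
  rfl

lemma chain {K : Type*} [Field K] (M : Matrix (Fin 4) (Fin 4) K) (F : MvPolynomial (Fin 4) K)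
    (v : Fin 4 → K) (i : Fin 4) :
    eval v (pderiv i (bind₁ (fun i => ∑ j, C (M i j) * X j) F)) =
      ∑ k, eval (M.mulVec v) (pderiv k F) * M k i := by
  induction F using MvPolynomial.induction_on with
  | C a => simp
  | add p q hp hq => simp [hp, hq, add_mul, Finset.sum_add_distrib]
  | mul_X p a h =>
    simp only [map_mul, Derivation.leibniz, smul_eq_mul, map_add, h, eval_bind, add_mul,
      Finset.sum_add_distrib]
    congr 1
    · simp [pderiv_X, Pi.single_apply, Finset.sum_ite_eq, Matrix.mulVec, dotProduct]
    · simp only [Finset.mul_sum, mul_assoc]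

def dirD {K : Type*} [Field K] (x v : Fin 3 → K) : MvPolynomial (Fin 3) K →ₗ[K] K where
  toFun f := ∑ k, v k * eval x (pderiv k f)
  map_add' f g := by simp [mul_add, Finset.sum_add_distrib]
  map_smul' c f := by
    simp only [Derivation.map_smul, smul_eval, RingHom.id_apply, smul_eq_mul, Finset.mul_sum]
    refine Finset.sum_congr rfl fun k _ => by ring

lemma dirD_apply {K : Type*} [Field K] (x v : Fin 3 → K) (f : MvPolynomial (Fin 3) K) :
    dirD x v f = ∑ k, v k * eval x (pderiv k f) := rfl

lemma dirD_mul {K : Type*} [Field K] (x v : Fin 3 → K) (f g : MvPolynomial (Fin 3) K) :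
    dirD x v (f * g) = eval x f * dirD x v g + eval x g * dirD x v f := by
  simp only [dirD_apply, Derivation.leibniz, smul_eq_mul, map_add, map_mul, Finset.mul_sum,
    ← Finset.sum_add_distrib]
  refine Finset.sum_congr rfl fun k _ => by ring

def linF {K : Type*} [Field K] (a : Fin 3 → K) : MvPolynomial (Fin 3) K := ∑ k, C (a k) * X k

lemma linF_hom {K : Type*} [Field K] (a : Fin 3 → K) : (linF a).IsHomogeneous 1 :=
  IsHomogeneous.sum _ _ _ fun k _ => isHomogeneous_C_mul_X _ _

lemma eval_linF {K : Type*} [Field K] (a x : Fin 3 → K) : eval x (linF a) = ∑ k, a k * x k := by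
  simp [linF]

lemma dirD_linF {K : Type*} [Field K] (a x v : Fin 3 → K) :
    dirD x v (linF a) = ∑ k, a k * v k := by
  simp only [dirD_apply, linF, map_sum, Derivation.leibniz, pderiv_X, pderiv_C, smul_eq_mul,
    map_add, map_mul, eval_C, mul_zero, add_zero]
  refine Finset.sum_congr rfl fun k _ => ?_
  simp [Pi.single_apply, mul_comm]

lemma exists_form {K : Type*} [Field K] (x y : Fin 3 → K) (h : LinearIndependent K ![x, y])
    (α β : K) : ∃ a : Fin 3 → K, (∑ k, a k * x k = α) ∧ (∑ k, a k * y k = β) := by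
  obtain ⟨g, hg⟩ := LinearMap.exists_extend ((Module.Basis.span h).constr K ![α, β])
  have key : ∀ i, g (![x, y] i) = ![α, β] i := by
    intro i
    have h1 := (Module.Basis.span h).constr_basis K ![α, β] i
    rw [← hg] at h1
    rw [← h1, LinearMap.comp_apply, Submodule.subtype_apply, Module.Basis.span_apply]
  refine ⟨fun k => g (Pi.single k 1), ?_, ?_⟩
  · have : g x = α := key 0
    rw [← this, LinearMap.pi_apply_eq_sum_univ g x]
    refine Finset.sum_congr rfl fun k _ => ?_
    rw [smul_eq_mul, mul_comm]
    congr 1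
    exact congrArg g (by ext j; simp [Pi.single_apply, eq_comm])
  · have : g y = β := key 1
    rw [← this, LinearMap.pi_apply_eq_sum_univ g y]
    refine Finset.sum_congr rfl fun k _ => ?_
    rw [smul_eq_mul, mul_comm]
    congr 1
    exact congrArg g (by ext j; simp [Pi.single_apply, eq_comm])

lemma exists_local {K : Type*} [Field K] (x v : Fin 7 → Fin 3 → K)
    (hx : ∀ i j, i ≠ j → LinearIndependent K ![x i, x j])
    (hv : ∀ i, LinearIndependent K ![x i, v i]) (i : Fin 7) (α β : K) :
    ∃ f : MvPolynomial (Fin 3) K, f.IsHomogeneous 13 ∧ eval (x i) f = α ∧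
      dirD (x i) (v i) f = β ∧ ∀ j, j ≠ i → eval (x j) f = 0 ∧ dirD (x j) (v j) f = 0 := by
  classical
  have h1 : ∀ j, ∃ a : Fin 3 → K, j ≠ i → (∑ k, a k * x j k = 0) ∧ (∑ k, a k * x i k = 1) := by
    intro j
    by_cases hj : j = i
    · exact ⟨0, fun h => absurd hj h⟩
    · obtain ⟨a, ha⟩ := exists_form (x j) (x i) (hx j i hj) 0 1
      exact ⟨a, fun _ => ha⟩
  choose a ha using h1
  set Q : MvPolynomial (Fin 3) K := ∏ j ∈ Finset.univ.erase i, (linF (a j)) ^ 2 with hQ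
  have hQi : eval (x i) Q = 1 := by
    rw [hQ, map_prod]
    refine Finset.prod_eq_one fun j hj => ?_
    rw [map_pow, eval_linF, (ha j (Finset.ne_of_mem_erase hj)).2, one_pow]
  obtain ⟨b, hb1, hb2⟩ := exists_form (x i) (v i) (hv i) α (β - α * dirD (x i) (v i) Q)
  refine ⟨Q * linF b, ?_, ?_, ?_, ?_⟩
  · have hh : Q.IsHomogeneous (∑ j ∈ Finset.univ.erase i, 2) :=
      IsHomogeneous.prod _ _ _ fun j _ => by simpa using (linF_hom (a j)).pow 2
    have hs : (∑ j ∈ (Finset.univ.erase i : Finset (Fin 7)), 2) = 12 := by simp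
    rw [hs] at hh
    exact hh.mul (linF_hom b)
  · rw [map_mul, hQi, eval_linF, hb1, one_mul]
  · rw [dirD_mul, hQi, eval_linF, dirD_linF, hb1, hb2]
    ring
  · intro j hj
    have hm : j ∈ (Finset.univ.erase i : Finset (Fin 7)) := by simp [hj]
    have h0 : eval (x j) (linF (a j)) = 0 := by rw [eval_linF, (ha j hj).1]
    rw [hQ, ← Finset.mul_prod_erase _ _ hm, pow_two, mul_assoc, mul_assoc]
    constructor
    · rw [map_mul, h0, zero_mul]
    · rw [dirD_mul, RingHom.map_mul, h0]
      ring

lemma core {K : Type*} [Field K] (G B : MvPolynomial (Fin 3) K) (hG : G.IsHomogeneous 3)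
    (hB : B.IsHomogeneous 4) (hB0 : B ≠ 0) (hrel : IsRelPrime G B)
    (x v : Fin 7 → Fin 3 → K)
    (hx : ∀ i j, i ≠ j → LinearIndependent K ![x i, x j])
    (hv : ∀ i, LinearIndependent K ![x i, v i])
    (hGx : ∀ i, eval (x i) G = 0) (hBx : ∀ i, eval (x i) B = 0)
    (hGv : ∀ i, dirD (x i) (v i) G = 0) (hBv : ∀ i, dirD (x i) (v i) B = 0) : False := by
  classical
  let R := fun n => homogeneousSubmodule (Fin 3) K n
  let T : (R 10 × R 9) →ₗ[K] R 13 :=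
    LinearMap.codRestrict (R 13)
      ((LinearMap.mulRight K G ∘ₗ (R 10).subtype).coprod (LinearMap.mulRight K B ∘ₗ (R 9).subtype))
      (by
        rintro ⟨⟨a, ha⟩, ⟨b, hb⟩⟩
        have h1 : (a * G).IsHomogeneous 13 := IsHomogeneous.mul (m := 10) ha hG
        have h2 : (b * B).IsHomogeneous 13 := IsHomogeneous.mul (m := 9) hb hB
        exact h1.add h2)
  have hT : ∀ a b, (T (a, b) : MvPolynomial (Fin 3) K) = a * G + b * B := fun a b => rfl
  let S : R 6 →ₗ[K] (R 10 × R 9) :=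
    (LinearMap.codRestrict (R 10) (LinearMap.mulRight K B ∘ₗ (R 6).subtype)
      (fun c => IsHomogeneous.mul c.2 hB)).prod
    (LinearMap.codRestrict (R 9) (LinearMap.mulRight K (-G) ∘ₗ (R 6).subtype)
      (fun c => IsHomogeneous.mul c.2 hG.neg))
  have hS1 : ∀ c, ((S c).1 : MvPolynomial (Fin 3) K) = c * B := fun c => rfl
  have hS2 : ∀ c, ((S c).2 : MvPolynomial (Fin 3) K) = c * (-G) := fun c => rfl
  have hker : LinearMap.ker T ≤ LinearMap.range S := by
    rintro ⟨a, b⟩ hab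
    have h1 : (a : MvPolynomial (Fin 3) K) * G + b * B = 0 := by
      rw [← hT, LinearMap.mem_ker.1 hab]; rfl
    have h2 : B ∣ (a : MvPolynomial (Fin 3) K) := by
      refine hrel.symm.dvd_of_dvd_mul_right ⟨-b, ?_⟩
      linear_combination h1
    obtain ⟨c, hc⟩ := h2
    rw [mul_comm] at hc
    have h3 := comp_mul c B 6 4 hB (by rw [← hc]; exact a.2)
    rw [← hc] at h3
    refine ⟨⟨homogeneousComponent 6 c, homogeneousComponent_isHomogeneous 6 c⟩, ?_⟩
    refine Prod.ext (Subtype.ext ?_) (Subtype.ext ?_)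
    · rw [hS1]; exact h3.symm
    · rw [hS2]
      apply mul_right_cancel₀ hB0
      simp only
      rw [h3] at h1
      linear_combination -h1
  let E : R 13 →ₗ[K] (Fin 7 → K × K) :=
    (LinearMap.pi fun i => ((aeval (x i)).toLinearMap).prod (dirD (x i) (v i))) ∘ₗ (R 13).subtype
  have hE : ∀ f i, E f i = (eval (x i) (f : MvPolynomial (Fin 3) K), dirD (x i) (v i) f) :=
    fun f i => by
      rw [← aeval_eq_eval]; rfl
  have hEs : Function.Surjective E := by
    intro w
    choose f hf1 hf2 hf3 hf4 using fun i => exists_local x v hx hv i (w i).1 (w i).2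
    refine ⟨∑ i, ⟨f i, hf1 i⟩, ?_⟩
    ext1 j
    rw [map_sum, Finset.sum_apply, Finset.sum_eq_single j]
    · rw [hE, hf2, hf3]
    · intro i _ hij
      rw [hE, (hf4 i j hij.symm).1, (hf4 i j hij.symm).2]; rfl
    · simp
  have hle : LinearMap.range T ≤ LinearMap.ker E := by
    rintro _ ⟨⟨a, b⟩, rfl⟩
    rw [LinearMap.mem_ker]
    ext1 i
    rw [hE, hT]
    simp [dirD_mul, hGx, hBx, hGv, hBv]
  have d1 := LinearMap.finrank_range_add_finrank_ker T
  have d2 := LinearMap.finrank_range_add_finrank_ker E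
  have d3 := Submodule.finrank_mono hker
  have d4 := LinearMap.finrank_range_le S
  have d5 := Submodule.finrank_mono hle
  rw [LinearMap.range_eq_top.2 hEs, finrank_top] at d2
  rw [Module.finrank_prod] at d1
  have r6 : Module.finrank K (R 6) = 28 := finrank_hom 6
  have r9 : Module.finrank K (R 9) = 55 := finrank_hom 9
  have r10 : Module.finrank K (R 10) = 66 := finrank_hom 10
  have r13 : Module.finrank K (R 13) = 105 := finrank_hom 13
  have r14 : Module.finrank K (Fin 7 → K × K) = 14 := by
    rw [Module.finrank_pi_fintype]
    simp
  omega

def coordHom (K : Type*) [Field K] (k : ℕ) : MvPolynomial (Fin 4) K →ₐ[K] MvPolynomial (Fin 4) K :=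
  aeval fun i : Fin 4 => if i.val < k then 0 else X i

def coordIdeal (K : Type*) [Field K] (k : ℕ) : Ideal (MvPolynomial (Fin 4) K) :=
  RingHom.ker (coordHom K k)

instance (K : Type*) [Field K] (k : ℕ) : (coordIdeal K k).IsPrime :=
  RingHom.ker_isPrime _

lemma coordIdeal_lt {K : Type*} [Field K] (k : ℕ) (hk : k < 4) :
    coordIdeal K k < coordIdeal K (k + 1) := by
  refine lt_of_le_of_ne ?_ ?_
  · have hc : (coordHom K (k+1)).comp (coordHom K k) = coordHom K (k+1) := by
      ext1 i
      simp only [coordHom, AlgHom.comp_apply, aeval_X]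
      by_cases hi : i.val < k
      · rw [if_pos hi, if_pos (by omega), map_zero]
      · rw [if_neg hi, aeval_X]
    intro p hp
    have hp' : coordHom K k p = 0 := hp
    change coordHom K (k+1) p = 0
    rw [← hc, AlgHom.comp_apply, hp', map_zero]
  · intro h
    have h1 : (X ⟨k, hk⟩ : MvPolynomial (Fin 4) K) ∈ coordIdeal K (k+1) := by
      change coordHom K (k+1) _ = 0
      simp [coordHom]
    rw [← h] at h1
    have h2 : coordHom K k (X ⟨k, hk⟩) = 0 := h1
    simp [coordHom] at h2

lemma height_origin (K : Type*) [Field K] (m : Ideal (MvPolynomial (Fin 4) K)) [m.IsPrime]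
    (hm : ∀ p, eval 0 p = 0 → p ∈ m) : 4 ≤ m.height := by
  have h : ∀ k : ℕ, k ≤ 4 → (k : ℕ∞) ≤ (coordIdeal K k).height := by
    intro k
    induction k with
    | zero => intro _; simp
    | succ k ih =>
      intro hk
      push_cast
      exact (add_le_add_left (ih (by omega)) 1).trans
        (Ideal.height_add_one_le_of_lt_of_isPrime (coordIdeal_lt k (by omega)))
  refine (h 4 le_rfl).trans (Ideal.height_mono ?_)
  intro p hp
  apply hm
  have hp' : coordHom K 4 p = 0 := hp
  have hc : (aeval (0 : Fin 4 → K)).comp (coordHom K 4) = aeval (0 : Fin 4 → K) := by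
    ext1 i
    simp [coordHom]
  rw [← aeval_eq_eval, ← hc, AlgHom.comp_apply, hp', map_zero]

lemma exists_avoid {K : Type*} [Field K] [Infinite K] (S : Finset (Fin 4 → K))
    (hS : ∀ s ∈ S, s ≠ 0) : ∃ a : Fin 4 → K, ∀ s ∈ S, ∑ i, a i * s i ≠ 0 := by
  classical
  let P : MvPolynomial (Fin 4) K := ∏ s ∈ S, ∑ i, C (s i) * X i
  have hP : P ≠ 0 := by
    refine Finset.prod_ne_zero_iff.2 fun s hs h => hS s hs ?_
    ext i
    have := congrArg (eval (Pi.single i 1)) h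
    simpa [Pi.single_apply] using this
  obtain ⟨a, ha⟩ : ∃ a, eval a P ≠ 0 := by
    by_contra hc
    push Not at hc
    exact hP (MvPolynomial.funext fun x => by simpa using hc x)
  refine ⟨a, fun s hs h => ha ?_⟩
  rw [map_prod]
  refine Finset.prod_eq_zero hs ?_
  rw [← h]
  simp [mul_comm]

lemma infinite_common {K : Type*} [Field K] [IsAlgClosed K] (H L : MvPolynomial (Fin 4) K)
    (hH : eval 0 H = 0) (hL : eval 0 L = 0) (S : Finset (Fin 4 → K)) (hS : ∀ s ∈ S, s ≠ 0)
    (h : ∀ v, v ≠ 0 → eval v H = 0 → eval v L = 0 → ∃ s ∈ S, ∃ c : K, c • s = v) : False := by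
  classical
  have : Infinite K := IsAlgClosed.instInfinite
  obtain ⟨a, ha⟩ := exists_avoid S hS
  let l : MvPolynomial (Fin 4) K := ∑ i, C (a i) * X i
  let T : Finset (MvPolynomial (Fin 4) K) := {H, L, l}
  let I := Ideal.span (T : Set (MvPolynomial (Fin 4) K))
  have hz : zeroLocus K I = {0} := by
    ext v
    rw [Set.mem_singleton_iff, zeroLocus_span]
    simp only [T, Finset.coe_insert, Finset.coe_singleton, Set.mem_insert_iff,
      Set.mem_singleton_iff, forall_eq_or_imp, forall_eq, Set.mem_ofPred_eq, aeval_eq_eval,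
      RingHom.coe_coe]
    constructor
    · rintro ⟨h1, h2, h3⟩
      by_contra hv
      obtain ⟨s, hs, c, rfl⟩ := h v hv h1 h2
      apply ha s hs
      have hc : c ≠ 0 := by rintro rfl; simp at hv
      apply mul_left_cancel₀ hc
      rw [mul_zero, ← h3, Finset.mul_sum]
      simp only [l, map_sum, map_mul, eval_C, eval_X, Pi.smul_apply, smul_eq_mul]
      exact Finset.sum_congr rfl fun i _ => by ring
    · rintro rfl
      exact ⟨hH, hL, by simp [l]⟩
  have hr := vanishingIdeal_zeroLocus_eq_radical (k := K) (K := K) I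
  rw [hz] at hr
  have hmax : (vanishingIdeal K ({0} : Set (Fin 4 → K))).IsMaximal :=
    isMaximal_iff_eq_vanishingIdeal_singleton.2 ⟨0, rfl⟩
  have : I.radical.IsPrime := by rw [← hr]; exact hmax.isPrime
  have hmin : I.radical ∈ I.minimalPrimes := by
    rw [← Ideal.radical_minimalPrimes, Ideal.minimalPrimes_eq_subsingleton_self]
    rfl
  have h1 := Ideal.height_le_card_of_mem_minimalPrimes_span_finset hmin
  have h2 : 4 ≤ I.radical.height := by
    apply height_origin
    intro p hp
    rw [← hr, mem_vanishingIdeal_singleton_iff]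
    exact hp
  have h3 : T.card ≤ 3 := Finset.card_le_three
  have h4 : (4 : ℕ∞) ≤ (3 : ℕ) := h2.trans (h1.trans (by exact_mod_cast h3))
  exact absurd h4 (by decide)

lemma eval_smul_hom {K σ : Type*} [Field K] (p : MvPolynomial σ K) (n : ℕ)
    (hp : p.IsHomogeneous n) (c : K) (v : σ → K) : eval (c • v) p = c ^ n * eval v p := by
  rw [eval_eq, eval_eq, Finset.mul_sum]
  refine Finset.sum_congr rfl fun d hd => ?_
  have hdeg : d.degree = n := by
    by_contra h
    exact (mem_support_iff.1 hd) (hp.coeff_eq_zero h)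
  simp only [Pi.smul_apply, smul_eq_mul, mul_pow, Finset.prod_mul_distrib,
    Finset.prod_pow_eq_pow_sum]
  rw [← hdeg, Finsupp.degree_apply]
  ring

/-- `v` is a (cone) singular vector of `F`. -/
def SingVec {K : Type*} [Field K] (F : MvPolynomial (Fin 4) K) (v : Fin 4 → K) : Prop :=
  eval v F = 0 ∧ ∀ i, eval v (pderiv i F) = 0

lemma mk_mem_singLocus {K : Type*} [Field K] (F : MvPolynomial (Fin 4) K) (n : ℕ)
    (hF : F.IsHomogeneous n) (v : Fin 4 → K) (hv : v ≠ 0) :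
    Projectivization.mk K v hv ∈ singLocus F ↔ SingVec F v := by
  constructor
  · intro h
    exact h v hv rfl
  · rintro ⟨h1, h2⟩ w hw hwv
    rw [Projectivization.mk_eq_mk_iff'] at hwv
    obtain ⟨a, rfl⟩ := hwv
    refine ⟨?_, fun i => ?_⟩
    · rw [eval_smul_hom _ _ hF, h1, mul_zero]
    · rw [eval_smul_hom _ _ hF.pderiv, h2, mul_zero]

abbrev emb : Fin 3 → Fin 4 := Fin.castLE (by norm_num : (3:ℕ) ≤ 4)

lemma emb_inj : Function.Injective emb := Fin.castLE_injective _

lemma emb_ne (k : Fin 3) : emb k ≠ 3 := by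
  revert k; decide

def Ftil {K : Type*} [Field K] (G B : MvPolynomial (Fin 3) K) : MvPolynomial (Fin 4) K :=
  X 3 * rename emb G + rename emb B

def vec {K : Type*} (x : Fin 3 → K) (z : K) : Fin 4 → K := ![x 0, x 1, x 2, z]

lemma vec_emb {K : Type*} (x : Fin 3 → K) (z : K) : vec x z ∘ emb = x := by
  ext k; fin_cases k <;> rfl

lemma vec_three {K : Type*} (x : Fin 3 → K) (z : K) : vec x z 3 = z := rfl

lemma vec_eta {K : Type*} (u : Fin 4 → K) : vec (u ∘ emb) (u 3) = u := by
  ext k; fin_cases k <;> rfl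

lemma smul_vec {K : Type*} [Field K] (c : K) (x : Fin 3 → K) (z : K) :
    c • vec x z = vec (c • x) (c * z) := by
  ext k; fin_cases k <;> rfl

lemma vec_ne_zero {K : Type*} [Field K] (x : Fin 3 → K) (z : K) (hx : x ≠ 0) : vec x z ≠ 0 := by
  intro h
  apply hx
  rw [← vec_emb x z, h]
  rfl

lemma pderiv_three_rename {K : Type*} [Field K] (p : MvPolynomial (Fin 3) K) :
    pderiv 3 (rename emb p) = 0 := by
  classical
  apply pderiv_eq_zero_of_notMem_vars
  intro h
  have h2 := vars_rename emb p h
  obtain ⟨k, _, hk⟩ := Finset.mem_image.1 h2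
  exact emb_ne k hk

lemma singVec_iff {K : Type*} [Field K] (G B : MvPolynomial (Fin 3) K) (x : Fin 3 → K) (z : K) :
    SingVec (Ftil G B) (vec x z) ↔ eval x G = 0 ∧ eval x B = 0 ∧
      ∀ k, z * eval x (pderiv k G) + eval x (pderiv k B) = 0 := by
  have h0 : eval (vec x z) (Ftil G B) = z * eval x G + eval x B := by
    simp only [Ftil, map_add, map_mul, eval_X, eval_rename, vec_emb, vec_three]
  have h3 : eval (vec x z) (pderiv 3 (Ftil G B)) = eval x G := by
    simp only [Ftil, map_add, Derivation.leibniz, pderiv_three_rename, pderiv_X_self, smul_eq_mul]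
    simp [eval_rename, vec_emb]
  have hk : ∀ k, eval (vec x z) (pderiv (emb k) (Ftil G B)) =
      z * eval x (pderiv k G) + eval x (pderiv k B) := by
    intro k
    simp only [Ftil, map_add, Derivation.leibniz, pderiv_rename emb_inj, smul_eq_mul]
    rw [pderiv_X_of_ne (emb_ne k).symm]
    simp [eval_rename, vec_emb, vec_three]
  constructor
  · rintro ⟨a, b⟩
    have hG : eval x G = 0 := by rw [← h3]; exact b 3
    refine ⟨hG, ?_, fun k => ?_⟩
    · rw [h0, hG] at a; simpa using a
    · rw [← hk]; exact b _
  · rintro ⟨a, b, c⟩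
    refine ⟨by rw [h0, a, b]; simp, fun i => ?_⟩
    by_cases hi : i = 3
    · subst hi; rw [h3, a]
    · obtain ⟨k, rfl⟩ : ∃ k, emb k = i := by
        revert i; decide
      rw [hk, c]

lemma Ftil_hom {K : Type*} [Field K] {G B : MvPolynomial (Fin 3) K} (hG : G.IsHomogeneous 3)
    (hB : B.IsHomogeneous 4) : (Ftil G B).IsHomogeneous 4 := by
  have h1 : (X 3 * rename emb G : MvPolynomial (Fin 4) K).IsHomogeneous (1 + 3) :=
    (isHomogeneous_X K 3).mul hG.rename_isHomogeneous
  exact h1.add hB.rename_isHomogeneous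

lemma infinite_of_line {K : Type*} [Field K] [Infinite K] {G B : MvPolynomial (Fin 3) K}
    (hG : G.IsHomogeneous 3) (hB : B.IsHomogeneous 4) (x : Fin 3 → K) (hx : x ≠ 0)
    (h1 : eval x G = 0) (h2 : eval x B = 0) (h3 : ∀ k, eval x (pderiv k G) = 0)
    (h4 : ∀ k, eval x (pderiv k B) = 0) : ¬ (singLocus (Ftil G B)).Finite := by
  refine Set.infinite_of_injective_forall_mem (α := K)
    (f := fun z => Projectivization.mk K (vec x z) (vec_ne_zero x z hx)) ?_ ?_
  · intro z w h
    simp only [Projectivization.mk_eq_mk_iff'] at h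
    obtain ⟨a, ha⟩ := h
    rw [smul_vec] at ha
    have e1 : a • x = x := by
      have := congrArg (fun u => u ∘ emb) ha
      simpa only [vec_emb] using this
    have e2 : a * w = z := congrFun ha 3
    have e3 : a = 1 := by
      by_contra hne
      apply hx
      have : (a - 1) • x = 0 := by rw [sub_smul, e1, one_smul, sub_self]
      exact (smul_eq_zero.1 this).resolve_left (sub_ne_zero.2 hne)
    rw [← e2, e3, one_mul]
  · intro z
    rw [mk_mem_singLocus _ 4 (Ftil_hom hG hB), singVec_iff]
    exact ⟨h1, h2, fun k => by rw [h3, h4]; simp⟩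

lemma relPrime_of_finite {K : Type*} [Field K] [IsAlgClosed K] {G B : MvPolynomial (Fin 3) K}
    (hG : G.IsHomogeneous 3) (hG0 : G ≠ 0) (hB : B.IsHomogeneous 4)
    (hfin : (singLocus (Ftil G B)).Finite) : IsRelPrime G B := by
  classical
  rintro H ⟨G', hG'⟩ ⟨B', hB'⟩
  by_contra hu
  have hH0 : coeff 0 H = 0 := by
    by_contra h
    exact hu (isUnit_of_coeff_zero H G' 3 (hG' ▸ hG) (hG' ▸ hG0) h)
  have hB0 : coeff 0 B' = 0 := by
    by_cases hBz : B = 0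
    · have hHne : H ≠ 0 := by rintro rfl; simp at hG'; exact hG0 hG'
      have : B' = 0 := by
        rw [hBz] at hB'
        exact (mul_eq_zero.1 hB'.symm).resolve_left hHne
      rw [this, coeff_zero]
    · by_contra h
      rw [mul_comm] at hB'
      have hu' : IsUnit B' := isUnit_of_coeff_zero B' H 4 (hB' ▸ hB) (hB' ▸ hBz) h
      have hd : B ∣ G := by
        rw [hB', hG']
        exact hu'.mul_left_dvd.2 (dvd_mul_right _ _)
      have := totalDegree_le_of_dvd_of_isDomain hd hG0
      rw [hB.totalDegree hBz, hG.totalDegree hG0] at this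
      omega
  have hfac : Ftil G B = rename emb H * Ftil G' B' := by
    rw [Ftil, Ftil, hG', hB', map_mul, map_mul]; ring
  refine infinite_common (rename emb H) (Ftil G' B') ?_ ?_
    (hfin.toFinset.image fun p => p.rep) ?_ ?_
  · have : (0 : Fin 4 → K) ∘ emb = 0 := rfl
    rw [eval_rename, this]
    simpa [constantCoeff_eq] using hH0
  · have : (0 : Fin 4 → K) ∘ emb = 0 := rfl
    simp only [Ftil, map_add, map_mul, eval_X, eval_rename, this, Pi.zero_apply, zero_mul, zero_add]
    simpa [constantCoeff_eq] using hB0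
  · intro s hs
    obtain ⟨p, _, rfl⟩ := Finset.mem_image.1 hs
    exact p.rep_nonzero
  · intro v hv h1 h2
    have hs : SingVec (Ftil G B) v := by
      rw [hfac]
      refine ⟨by rw [map_mul, h1, zero_mul], fun i => ?_⟩
      rw [Derivation.leibniz, map_add, smul_eq_mul, smul_eq_mul, map_mul, map_mul, h1, h2]
      simp
    rw [← mk_mem_singLocus _ 4 (Ftil_hom hG hB) v hv] at hs
    obtain ⟨a, ha⟩ := Projectivization.exists_smul_eq_mk_rep K v hv
    refine ⟨_, Finset.mem_image.2 ⟨_, hfin.mem_toFinset.2 hs, rfl⟩, ((a⁻¹ : Kˣ) : K), ?_⟩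
    rw [← ha]
    exact inv_smul_smul a v

lemma exists_tangent {K : Type*} [Field K] (g x : Fin 3 → K) (hx : x ≠ 0) :
    ∃ w : Fin 3 → K, LinearIndependent K ![x, w] ∧ ∑ k, w k * g k = 0 := by
  let φ : (Fin 3 → K) →ₗ[K] K := ∑ k, g k • LinearMap.proj k
  have hφ : ∀ w, φ w = ∑ k, w k * g k := by
    intro w; simp [φ, mul_comm]
  have hd := LinearMap.finrank_range_add_finrank_ker φ
  have hr := Submodule.finrank_le (LinearMap.range φ)
  simp only [Module.finrank_self, Module.finrank_fin_fun] at hd hr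
  have hn : ¬ LinearMap.ker φ ≤ Submodule.span K {x} := by
    intro h
    have h1 := Submodule.finrank_mono h
    rw [finrank_span_singleton hx] at h1
    omega
  obtain ⟨w, hw1, hw2⟩ := Set.not_subset.1 hn
  refine ⟨w, ?_, by rw [← hφ]; exact hw1⟩
  rw [LinearIndependent.pair_iff' hx]
  intro a ha
  exact hw2 (Submodule.mem_span_singleton.2 ⟨a, ha⟩)

lemma main_til {K : Type*} [Field K] [IsAlgClosed K] {G B : MvPolynomial (Fin 3) K}
    (hG : G.IsHomogeneous 3) (hG0 : G ≠ 0) (hB : B.IsHomogeneous 4)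
    (hfin : (singLocus (Ftil G B)).Finite) : (singLocus (Ftil G B)).ncard ≤ 7 := by
  classical
  have : Infinite K := IsAlgClosed.instInfinite
  have hrel := relPrime_of_finite hG hG0 hB hfin
  have hB0 : B ≠ 0 := by
    rintro rfl
    have hu : IsUnit G := hrel dvd_rfl (dvd_zero _)
    have := totalDegree_le_of_dvd_of_isDomain (hu.dvd : G ∣ 1) one_ne_zero
    rw [hG.totalDegree hG0] at this
    simp at this
  by_contra hcard
  push Not at hcard
  have hP0 : vec (0 : Fin 3 → K) 1 ≠ 0 := by
    intro h
    have := congrFun h 3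
    rw [vec_three] at this
    exact one_ne_zero this
  let P := Projectivization.mk K (vec (0 : Fin 3 → K) 1) hP0
  rw [Set.ncard_eq_toFinset_card _ hfin] at hcard
  have hc : 7 ≤ (hfin.toFinset.erase P).card := by
    have := Finset.pred_card_le_card_erase (s := hfin.toFinset) (a := P)
    omega
  obtain ⟨p⟩ : Nonempty (Fin 7 ↪ (hfin.toFinset.erase P)) :=
    Function.Embedding.nonempty_of_card_le (by simpa using hc)
  have hpP : ∀ i, (p i).1 ≠ P := fun i => Finset.ne_of_mem_erase (p i).2
  have hpS : ∀ i, (p i).1 ∈ singLocus (Ftil G B) := fun i =>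
    hfin.mem_toFinset.1 (Finset.mem_of_mem_erase (p i).2)
  let x : Fin 7 → Fin 3 → K := fun i => (p i).1.rep ∘ emb
  let z : Fin 7 → K := fun i => (p i).1.rep 3
  have hrep : ∀ i, vec (x i) (z i) = (p i).1.rep := fun i => vec_eta _
  have hx0 : ∀ i, x i ≠ 0 := by
    intro i h
    apply hpP i
    rw [← Projectivization.mk_rep (p i).1, Projectivization.mk_eq_mk_iff']
    refine ⟨z i, ?_⟩
    rw [← hrep, smul_vec, h, smul_zero, mul_one]
  have hsing : ∀ i, SingVec (Ftil G B) (vec (x i) (z i)) := by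
    intro i
    rw [← mk_mem_singLocus _ 4 (Ftil_hom hG hB) _ (vec_ne_zero _ _ (hx0 i))]
    simp only [hrep, Projectivization.mk_rep]
    exact hpS i
  have hs := fun i => (singVec_iff G B (x i) (z i)).1 (hsing i)
  choose w hw1 hw2 using fun i => exists_tangent (fun k => eval (x i) (pderiv k G)) (x i) (hx0 i)
  refine core G B hG hB hB0 hrel x w ?_ hw1 (fun i => (hs i).1) (fun i => (hs i).2.1) hw2 ?_
  · intro i j hij
    rw [LinearIndependent.pair_iff' (hx0 i)]
    intro a ha
    have ha0 : a ≠ 0 := by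
      rintro rfl
      apply hx0 j
      rw [← ha, zero_smul]
    have hv : a • vec (x i) (a⁻¹ * z j) = vec (x j) (z j) := by
      rw [smul_vec, ha, mul_inv_cancel_left₀ ha0]
    have hmk : Projectivization.mk K _ (vec_ne_zero (x i) (a⁻¹ * z j) (hx0 i)) = (p j).1 := by
      rw [← Projectivization.mk_rep (p j).1, Projectivization.mk_eq_mk_iff']
      refine ⟨a⁻¹, ?_⟩
      rw [← hrep, ← hv, inv_smul_smul₀ ha0]
    have hs' := hpS j
    rw [← hmk, mk_mem_singLocus _ 4 (Ftil_hom hG hB), singVec_iff] at hs'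
    have hne : z i - a⁻¹ * z j ≠ 0 := by
      intro h
      apply hij
      apply p.injective
      apply Subtype.ext
      rw [← hmk, ← Projectivization.mk_rep (p i).1]
      simp only [← sub_eq_zero.1 h, hrep]
    have hgG : ∀ k, eval (x i) (pderiv k G) = 0 := by
      intro k
      apply mul_left_cancel₀ hne
      linear_combination (hs i).2.2 k - hs'.2.2 k
    refine infinite_of_line hG hB (x i) (hx0 i) (hs i).1 (hs i).2.1 hgG (fun k => ?_) hfin
    have := (hs i).2.2 k
    rwa [hgG, mul_zero, zero_add] at this
  · intro i
    have h1 : ∀ k, eval (x i) (pderiv k B) = - z i * eval (x i) (pderiv k G) := fun k => by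
      linear_combination (hs i).2.2 k
    have h2 := hw2 i
    rw [dirD_apply]
    simp only [h1]
    calc _ = - z i * ∑ k, w i k * eval (x i) (pderiv k G) := by
          rw [Finset.mul_sum]
          exact Finset.sum_congr rfl fun k _ => by ring
      _ = 0 := by rw [h2, mul_zero]

lemma singVec_bind {K : Type*} [Field K] (M : Matrix (Fin 4) (Fin 4) K) (hM : IsUnit M.det)
    (F : MvPolynomial (Fin 4) K) (u : Fin 4 → K) :
    SingVec (bind₁ (fun i => ∑ j, C (M i j) * X j) F) u ↔ SingVec F (M.mulVec u) := by
  unfold SingVec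
  rw [eval_bind]
  refine and_congr_right fun _ => ?_
  simp only [chain]
  constructor
  · intro h
    have : Matrix.vecMul (fun k => eval (M.mulVec u) (pderiv k F)) M = 0 := by
      ext i
      exact h i
    have h0 := Matrix.eq_zero_of_vecMul_eq_zero hM.ne_zero this
    exact fun i => congrFun h0 i
  · intro h i
    exact Finset.sum_eq_zero fun k _ => by rw [h, zero_mul]

theorem quartic_singular_count_le_seven_of_triple_point
    {K : Type*} [Field K] [IsAlgClosed K]
    (F : MvPolynomial (Fin 4) K) (hF0 : F ≠ 0) (hFhom : F.IsHomogeneous 4)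
    (htriple : ∃ M : Matrix (Fin 4) (Fin 4) K, IsUnit M.det ∧
      ∃ G B : MvPolynomial (Fin 3) K,
        G.IsHomogeneous 3 ∧ G ≠ 0 ∧ B.IsHomogeneous 4 ∧
        bind₁ (fun i => ∑ j, C (M i j) * X j) F
          = X 3 * rename (Fin.castLE (by norm_num : (3:ℕ) ≤ 4)) G
            + rename (Fin.castLE (by norm_num : (3:ℕ) ≤ 4)) B)
    (hfin : (singLocus F).Finite) :
    (singLocus F).ncard ≤ 7 := by
  obtain ⟨M, hM, G, B, hG, hG0, hB, hFM⟩ := htriple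
  have hFM' : bind₁ (fun i => ∑ j, C (M i j) * X j) F = Ftil G B := hFM
  have hinj : Function.Injective M.mulVecLin :=
    Matrix.mulVec_injective_of_isUnit ((Matrix.isUnit_iff_isUnit_det M).2 hM)
  have himg : singLocus F = Set.image (Projectivization.map M.mulVecLin hinj) (singLocus (Ftil G B)) := by
    ext q
    constructor
    · induction q using Projectivization.ind with
      | h v hv =>
        intro hq
        rw [mk_mem_singLocus F 4 hFhom] at hq
        have hMv : M.mulVec (M⁻¹.mulVec v) = v := by
          rw [Matrix.mulVec_mulVec, Matrix.mul_nonsing_inv _ hM, Matrix.one_mulVec]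
        have hu : M⁻¹.mulVec v ≠ 0 := by
          intro h
          rw [h, Matrix.mulVec_zero] at hMv
          exact hv hMv.symm
        refine ⟨Projectivization.mk K _ hu, ?_, ?_⟩
        · rw [mk_mem_singLocus _ 4 (Ftil_hom hG hB), ← hFM', singVec_bind M hM, hMv]
          exact hq
        · rw [Projectivization.map_mk]
          simp only [Matrix.mulVecLin_apply, hMv]
    · rintro ⟨r, hr, rfl⟩
      induction r using Projectivization.ind with
      | h u hu =>
        rw [mk_mem_singLocus _ 4 (Ftil_hom hG hB), ← hFM', singVec_bind M hM] at hr
        rw [Projectivization.map_mk, mk_mem_singLocus F 4 hFhom]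
        exact hr
  have hmi := Projectivization.map_injective M.mulVecLin hinj
  rw [himg] at hfin ⊢
  rw [Set.ncard_image_of_injective _ hmi]
  exact main_til hG hG0 hB (hfin.of_finite_image hmi.injOn)

end
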